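/- Let 𝒰 be a partition of 𝒱 into b ≥ 4 parts each of size a ≥ 2, v = ab, and k = a·k₀ with 1 ≤ k₀ ≤ b−1. Let Γ₀ be a nonempty set of k₀-subsets of 𝒰 and Γ = Γ(a,Γ₀). Then every element of the wreath-product group W preserves Γ (so W is contained in the group of permutations of 𝒱 preserving Γ), and δ(Γ) = a·δ(Γ₀). -/

import Mathlib

variable {α : Type*} [DecidableEq α]

/-- The image of a finset under a permutation. -/
def pact (g : Equiv.Perm α) (s : Finset α) : Finset α := s.image g

/-- Adjacency in the Johnson graph `J(v,k)`: two `k`-subsets meeting in `k-1` points. -/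
def JAdj (k : ℕ) (s t : Finset α) : Prop := s ≠ t ∧ (s ∩ t).card = k - 1

/-- The neighbour set `Γ₁` of a code `Γ` of `k`-subsets: the `k`-subsets not in `Γ`
adjacent to at least one member of `Γ`. -/
def nbrSet (k : ℕ) (Γ : Set (Finset α)) : Set (Finset α) :=
  {β | β.card = k ∧ β ∉ Γ ∧ ∃ γ ∈ Γ, JAdj k γ β}

/-- `G` leaves `Γ` invariant. -/
def Invariant (G : Set (Equiv.Perm α)) (Γ : Set (Finset α)) : Prop :=
  ∀ g ∈ G, ∀ γ ∈ Γ, pact g γ ∈ Γ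

/-- `G` is transitive on the collection `Γ` of finsets. -/
def TransOn (G : Set (Equiv.Perm α)) (Γ : Set (Finset α)) : Prop :=
  ∀ γ ∈ Γ, ∀ γ' ∈ Γ, ∃ g ∈ G, pact g γ = γ'

/-- `G` is transitive on the points. -/
def TransOnPts (G : Set (Equiv.Perm α)) : Prop := ∀ x y : α, ∃ g ∈ G, g x = y

/-- `Γ` is `G`-neighbour-transitive: `G` is transitive on `Γ` and on its neighbour set. -/
def NbrTrans (G : Set (Equiv.Perm α)) (k : ℕ) (Γ : Set (Finset α)) : Prop :=
  TransOn G Γ ∧ TransOn G (nbrSet k Γ)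

/-- `Γ` is `G`-incidence-transitive: `G` is transitive on adjacent pairs
`(γ, γ₁) ∈ Γ × Γ₁`. -/
def IncTrans (G : Set (Equiv.Perm α)) (k : ℕ) (Γ : Set (Finset α)) : Prop :=
  ∀ γ ∈ Γ, ∀ γ₁ ∈ nbrSet k Γ, JAdj k γ γ₁ →
    ∀ γ' ∈ Γ, ∀ γ₁' ∈ nbrSet k Γ, JAdj k γ' γ₁' →
      ∃ g ∈ G, pact g γ = γ' ∧ pact g γ₁ = γ₁'

/-- `Γ` is `G`-strongly incidence-transitive: `G` is transitive on `Γ` and, for each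
`γ ∈ Γ`, the setwise stabiliser of `γ` is transitive on `γ × (𝒱 ∖ γ)`. -/
def StrIncTrans (G : Set (Equiv.Perm α)) (Γ : Set (Finset α)) : Prop :=
  TransOn G Γ ∧
  ∀ γ ∈ Γ, ∀ u ∈ γ, ∀ w ∉ γ, ∀ u' ∈ γ, ∀ w' ∉ γ,
    ∃ g ∈ G, pact g γ = γ ∧ g u = u' ∧ g w = w'

/-- The minimum (Johnson) distance of `Γ` is at least `d`. -/
def MinDistGE (d : ℕ) (Γ : Set (Finset α)) : Prop :=
  ∀ s ∈ Γ, ∀ t ∈ Γ, s ≠ t → d ≤ s.card - (s ∩ t).card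

/-- The minimum (Johnson) distance of a code `Γ`. -/
noncomputable def minDist (Γ : Set (Finset α)) : ℕ :=
  sInf {d | ∃ s ∈ Γ, ∃ t ∈ Γ, s ≠ t ∧ d = s.card - (s ∩ t).card}

/-- `𝒰` is a partition of the point set into `b` parts each of size `a`. -/
def IsPartitionInto (𝒰 : Finset (Finset α)) (a b : ℕ) [Fintype α] : Prop :=
  𝒰.card = b ∧ (∀ U ∈ 𝒰, U.card = a) ∧
  (∀ U ∈ 𝒰, ∀ W ∈ 𝒰, U ≠ W → Disjoint U W) ∧ 𝒰.biUnion id = Finset.univ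

/-- The `𝒰`-type of a subset `s`: the multiset of sizes of its intersections with the
parts of `𝒰`. -/
def utype (𝒰 : Finset (Finset α)) (s : Finset α) : Multiset ℕ :=
  𝒰.val.map fun U => (s ∩ U).card

/-- The seven admissible `𝒰`-types (with their side conditions) for a `k`-subset,
for a partition into `b` parts of size `a` of a `v`-set. -/
def AdmissibleType (a b v k : ℕ) (t : Multiset ℕ) : Prop :=
  -- (1) {k, 0^{b-1}}, k ≤ a
  (t = k ::ₘ Multiset.replicate (b - 1) 0 ∧ k ≤ a) ∨
  -- (2) {k-v+a, a^{b-1}}, k ≥ v-a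
  (t = (k - (v - a)) ::ₘ Multiset.replicate (b - 1) a ∧ v - a ≤ k) ∨
  -- (3) {1^k, 0^{b-k}}, k ≤ b
  (t = Multiset.replicate k 1 + Multiset.replicate (b - k) 0 ∧ k ≤ b) ∨
  -- (4) {(a-1)^{v-k}, a^{b-v+k}}, k ≥ v-b
  (t = Multiset.replicate (v - k) (a - 1) + Multiset.replicate (b - (v - k)) a ∧
    v - b ≤ k) ∨
  -- (5) {c^b}, k = c·b, 1 < c ≤ a-1
  (∃ c, t = Multiset.replicate b c ∧ k = c * b ∧ 1 < c ∧ c ≤ a - 1) ∨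
  -- (6) {(k-1)/2, (k+1)/2}, k odd, a ≥ 3, b = 2
  (t = (k - 1) / 2 ::ₘ (k + 1) / 2 ::ₘ (0 : Multiset ℕ) ∧ Odd k ∧ 3 ≤ a ∧ b = 2) ∨
  -- (7) {1, 2^{(k-1)/2}, 0^{b-(k+1)/2}}, k odd, a = 2, b ≥ 3
  (t = 1 ::ₘ (Multiset.replicate ((k - 1) / 2) 2 +
        Multiset.replicate (b - (k + 1) / 2) 0) ∧ Odd k ∧ a = 2 ∧ 3 ≤ b)

/-- Membership in the wreath-product group `W ≅ S_a wr A`: permutations of the points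
mapping parts of `𝒰` to parts of `𝒰` and inducing on `𝒰` a permutation preserving
`Γ₀` (i.e. lying in `A`). -/
def Wmem (𝒰 : Finset (Finset α)) (Γ₀ : Set (Finset (Finset α)))
    (g : Equiv.Perm α) : Prop :=
  (∀ U ∈ 𝒰, pact g U ∈ 𝒰) ∧ (fun δ => δ.image (pact g)) '' Γ₀ = Γ₀

theorem aux_inter {V : Type*} [DecidableEq V] (𝒰 : Finset (Finset V))
    (hd : ∀ U ∈ 𝒰, ∀ W ∈ 𝒰, U ≠ W → Disjoint U W) (s t : Finset (Finset V))
    (hs : s ⊆ 𝒰) (ht : t ⊆ 𝒰) :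
    s.biUnion id ∩ t.biUnion id = (s ∩ t).biUnion id := by
  ext x
  simp only [Finset.mem_inter, Finset.mem_biUnion, id]
  constructor
  · rintro ⟨⟨U, hU, hxU⟩, W, hW, hxW⟩
    by_cases h : U = W
    · subst h
      exact ⟨U, ⟨hU, hW⟩, hxU⟩
    · exact absurd hxW (Finset.disjoint_left.mp (hd U (hs hU) W (ht hW) h) hxU)
  · rintro ⟨U, ⟨h1, h2⟩, hx⟩
    exact ⟨⟨U, h1, hx⟩, U, h2, hx⟩

theorem aux_card {V : Type*} [DecidableEq V] (𝒰 : Finset (Finset V)) (a : ℕ)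
    (hc : ∀ U ∈ 𝒰, U.card = a)
    (hd : ∀ U ∈ 𝒰, ∀ W ∈ 𝒰, U ≠ W → Disjoint U W) (s : Finset (Finset V))
    (hs : s ⊆ 𝒰) : (s.biUnion id).card = a * s.card := by
  rw [Finset.card_biUnion (t := id) (fun U hU W hW h => hd U (hs hU) W (hs hW) h),
    Finset.sum_congr rfl (fun U hU => show (id U).card = a from hc U (hs hU))]
  simp [mul_comm]

theorem aux_pact {V : Type*} [DecidableEq V] (g : Equiv.Perm V) (s : Finset (Finset V)) :
    pact g (s.biUnion id) = (s.image (pact g)).biUnion id := by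
  ext x
  simp only [pact, Finset.mem_image, Finset.mem_biUnion, id]
  constructor
  · rintro ⟨y, ⟨U, hU, hy⟩, rfl⟩
    exact ⟨_, ⟨U, hU, rfl⟩, Finset.mem_image_of_mem _ hy⟩
  · rintro ⟨_, ⟨U, hU, rfl⟩, hx⟩
    obtain ⟨y, hy, rfl⟩ := Finset.mem_image.mp hx
    exact ⟨y, ⟨U, hU, hy⟩, rfl⟩

theorem aux_sInf (a : ℕ) (D : Set ℕ) : sInf ((fun d => a * d) '' D) = a * sInf D := by
  rcases D.eq_empty_or_nonempty with rfl | hD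
  · simp
  · apply le_antisymm
    · exact Nat.sInf_le ⟨_, Nat.sInf_mem hD, rfl⟩
    · obtain ⟨d, hd, h⟩ := Nat.sInf_mem (hD.image (fun d => a * d))
      rw [← h]
      exact Nat.mul_le_mul_left a (Nat.sInf_le hd)

/-- Example `ex:imprim2` and the first part of Lemma `lem:imprimex2`:
the wreath product `W = S_a wr A` preserves `Γ = Γ(a,Γ₀)`, and `δ(Γ) = a·δ(Γ₀)`. -/
theorem stmt7 {V : Type*} [Fintype V] [DecidableEq V] (a b k₀ : ℕ)
    (𝒰 : Finset (Finset V)) (hpart : IsPartitionInto 𝒰 a b)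
    (ha : 2 ≤ a) (hb : 4 ≤ b) (hk₀ : 1 ≤ k₀) (hk₀' : k₀ ≤ b - 1)
    (Γ₀ : Set (Finset (Finset V))) (hΓ₀ne : Γ₀.Nonempty)
    (hΓ₀ : ∀ γ₀ ∈ Γ₀, γ₀ ⊆ 𝒰 ∧ γ₀.card = k₀)
    (Γ : Set (Finset V))
    (hΓ : Γ = {s : Finset V | ∃ γ₀ ∈ Γ₀, s = γ₀.biUnion id}) :
    (∀ g : Equiv.Perm V, Wmem 𝒰 Γ₀ g → pact g '' Γ = Γ) ∧
    minDist Γ = a * minDist Γ₀ := by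
  obtain ⟨-, hc, hd, -⟩ := hpart
  subst hΓ
  constructor
  · rintro g ⟨-, hg⟩
    ext s
    constructor
    · rintro ⟨_, ⟨γ, hγ, rfl⟩, rfl⟩
      exact ⟨γ.image (pact g), hg ▸ ⟨γ, hγ, rfl⟩, aux_pact g γ⟩
    · rintro ⟨γ, hγ, rfl⟩
      rw [← hg] at hγ
      obtain ⟨γ', hγ', rfl⟩ := hγ
      exact ⟨_, ⟨γ', hγ', rfl⟩, aux_pact g γ'⟩
  · have key : ∀ s ∈ Γ₀, ∀ t ∈ Γ₀, (s.biUnion id).card - (s.biUnion id ∩ t.biUnion id).card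
        = a * (s.card - (s ∩ t).card) := by
      intro s hs t ht
      rw [aux_inter 𝒰 hd s t (hΓ₀ s hs).1 (hΓ₀ t ht).1, aux_card 𝒰 a hc hd s (hΓ₀ s hs).1,
        aux_card 𝒰 a hc hd (s ∩ t) (Finset.inter_subset_left.trans (hΓ₀ s hs).1),
        Nat.mul_sub]
    have inj : ∀ s ∈ Γ₀, ∀ t ∈ Γ₀, s.biUnion id = t.biUnion id → s = t := by
      intro s hs t ht h
      have h1 := key s hs t ht
      rw [← h, Finset.inter_self, Nat.sub_self] at h1
      have h2 : s.card - (s ∩ t).card = 0 := by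
        rcases Nat.mul_eq_zero.mp h1.symm with h | h <;> omega
      have h3 : s ∩ t = s := Finset.eq_of_subset_of_card_le Finset.inter_subset_left (by omega)
      exact Finset.eq_of_subset_of_card_le (Finset.inter_eq_left.mp h3)
        (by rw [(hΓ₀ s hs).2, (hΓ₀ t ht).2])
    unfold minDist
    rw [← aux_sInf]
    congr 1
    ext d
    constructor
    · rintro ⟨_, ⟨s, hs, rfl⟩, _, ⟨t, ht, rfl⟩, hne, rfl⟩
      exact ⟨_, ⟨s, hs, t, ht, fun h => hne (by rw [h]), rfl⟩, (key s hs t ht).symm⟩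
    · rintro ⟨_, ⟨s, hs, t, ht, hne, rfl⟩, rfl⟩
      exact ⟨_, ⟨s, hs, rfl⟩, _, ⟨t, ht, rfl⟩, fun h => hne (inj s hs t ht h),
        (key s hs t ht).symm⟩
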